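/- Let a, b, c, d be real numbers. Then the statement ρ_A(N,w) > ρ_B(N,w) holds in the wN limit — that is, there exists N* such that for every integer N ≥ N* there exists w* > 0 such that ρ_A(N,w) > ρ_B(N,w) for all 0 < w < w* — if and only if one of the following holds: (i) a + b > c + d, or (ii) a + b = c + d and b > c. -/

import Mathlib

open Filter Finset Topology

/-- Fitness of strategy A under weak selection. -/
noncomputable def fA (a b : ℝ) (N : ℕ) (w : ℝ) (i : ℕ) : ℝ :=
  1 + w * (a * ((i : ℝ) - 1) + b * ((N : ℝ) - (i : ℝ))) / ((N : ℝ) - 1)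

/-- Fitness of strategy B under weak selection. -/
noncomputable def fB (c d : ℝ) (N : ℕ) (w : ℝ) (i : ℕ) : ℝ :=
  1 + w * (c * (i : ℝ) + d * ((N : ℝ) - (i : ℝ) - 1)) / ((N : ℝ) - 1)

/-- Fixation probability of strategy A in the frequency-dependent Moran process. -/
noncomputable def rhoA (a b c d : ℝ) (N : ℕ) (w : ℝ) : ℝ :=
  1 / (1 + ∑ k ∈ Icc 1 (N - 1), ∏ j ∈ Icc 1 k, fB c d N w j / fA a b N w j)

/-- Fixation probability of strategy B in the frequency-dependent Moran process. -/
noncomputable def rhoB (a b c d : ℝ) (N : ℕ) (w : ℝ) : ℝ :=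
  1 / (1 + ∑ k ∈ Icc 1 (N - 1), ∏ j ∈ Icc 1 k, fA a b N w (N - j) / fB c d N w (N - j))

lemma aux_range (M : ℕ) (u : ℕ → ℝ) :
    1 + ∑ k ∈ Icc 1 M, ∏ j ∈ Icc 1 k, u j
      = ∑ k ∈ range (M + 1), ∏ j ∈ range k, u (j + 1) := by
  have hprod : ∀ k, ∏ j ∈ Icc 1 k, u j = ∏ j ∈ range k, u (j + 1) := by
    intro k
    induction k with
    | zero => simp
    | succ k ih => rw [Finset.prod_Icc_succ_top (by omega), ih, Finset.prod_range_succ]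
  induction M with
  | zero => simp
  | succ M ih =>
    rw [Finset.sum_Icc_succ_top (by omega), ← add_assoc, ih, Finset.sum_range_succ _ (M + 1), hprod]

lemma aux_prod (M : ℕ) (g : ℕ → ℝ) (hg : ∀ j, 1 ≤ j → j ≤ M → 0 < g j) (k : ℕ) (hk : k ≤ M) :
    (∏ j ∈ range M, g (j + 1)) * ∏ j ∈ range k, (g (M + 1 - (j + 1)))⁻¹
      = ∏ j ∈ range (M - k), g (j + 1) := by
  induction k with
  | zero => simp
  | succ k ih =>
    rw [Finset.prod_range_succ, ← mul_assoc, ih (by omega)]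
    obtain ⟨m, hm⟩ : ∃ m, M = m + 1 + k := ⟨M - (k + 1), by omega⟩
    have h1 : M - k = m + 1 := by omega
    have h2 : M - (k + 1) = m := by omega
    have h3 : M + 1 - (k + 1) = m + 1 := by omega
    rw [h1, h2, h3, Finset.prod_range_succ, mul_assoc, mul_inv_cancel₀, mul_one]
    exact (hg (m + 1) (by omega) (by omega)).ne'

lemma aux_sum (M : ℕ) (g : ℕ → ℝ) (hg : ∀ j, 1 ≤ j → j ≤ M → 0 < g j) :
    (∏ j ∈ range M, g (j + 1)) *
      (∑ k ∈ range (M + 1), ∏ j ∈ range k, (g (M + 1 - (j + 1)))⁻¹)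
      = ∑ k ∈ range (M + 1), ∏ j ∈ range k, g (j + 1) := by
  rw [Finset.mul_sum, ← Finset.sum_range_reflect (fun k => ∏ j ∈ range k, g (j + 1))]
  apply Finset.sum_congr rfl
  intro k hk
  rw [Finset.mem_range] at hk
  rw [aux_prod M g hg k (by omega)]
  congr 2

lemma rho_iff (a b c d : ℝ) (M : ℕ) (w : ℝ)
    (hA : ∀ j, 1 ≤ j → j ≤ M → 0 < fA a b (M + 1) w j)
    (hB : ∀ j, 1 ≤ j → j ≤ M → 0 < fB c d (M + 1) w j) :
    rhoA a b c d (M + 1) w > rhoB a b c d (M + 1) w ↔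
      ∏ j ∈ range M, fB c d (M + 1) w (j + 1) < ∏ j ∈ range M, fA a b (M + 1) w (j + 1) := by
  have hg : ∀ j, 1 ≤ j → j ≤ M → 0 < fB c d (M + 1) w j / fA a b (M + 1) w j :=
    fun j h1 h2 => div_pos (hB j h1 h2) (hA j h1 h2)
  have key := aux_sum M (fun j => fB c d (M + 1) w j / fA a b (M + 1) w j) hg
  have hP : 0 < ∏ j ∈ range M, fA a b (M + 1) w (j + 1) :=
    Finset.prod_pos fun j hj => hA _ (by omega) (by have := Finset.mem_range.1 hj; omega)
  unfold rhoA rhoB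
  rw [Nat.add_sub_cancel, aux_range M (fun j => fB c d (M + 1) w j / fA a b (M + 1) w j),
    aux_range M (fun j => fA a b (M + 1) w (M + 1 - j) / fB c d (M + 1) w (M + 1 - j))]
  simp only [inv_div] at key
  have hT : 0 < ∑ k ∈ range (M + 1), ∏ j ∈ range k,
      (fA a b (M + 1) w (M + 1 - (j + 1)) / fB c d (M + 1) w (M + 1 - (j + 1))) := by
    apply Finset.sum_pos
    · intro k hk
      apply Finset.prod_pos
      intro j hj
      have h1 := Finset.mem_range.1 hk
      have h2 := Finset.mem_range.1 hj
      exact div_pos (hA _ (by omega) (by omega)) (hB _ (by omega) (by omega))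
    · simp
  have hQ : 0 < ∏ j ∈ range M, (fB c d (M + 1) w (j + 1) / fA a b (M + 1) w (j + 1)) :=
    Finset.prod_pos fun j hj => hg _ (by omega) (by have := Finset.mem_range.1 hj; omega)
  rw [← key, gt_iff_lt, one_div_lt_one_div hT (mul_pos hQ hT), mul_lt_iff_lt_one_left hT,
    Finset.prod_div_distrib, div_lt_one hP]

lemma fin_prod_deriv (M : ℕ) (s : ℕ → ℝ) :
    HasDerivAt (fun w : ℝ => ∏ j ∈ range M, (1 + w * s j)) (∑ j ∈ range M, s j) 0 := by
  induction M with
  | zero => simpa using hasDerivAt_const (0 : ℝ) (1 : ℝ)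
  | succ M ih =>
    have h : HasDerivAt (fun w : ℝ => 1 + w * s M) (s M) 0 := by
      simpa using ((hasDerivAt_id (0 : ℝ)).mul_const (s M)).const_add 1
    have := ih.mul h
    simp only [Finset.prod_range_succ, Finset.sum_range_succ]
    exact this.congr_deriv (by simp)

lemma ev_pos {F : ℝ → ℝ} {D : ℝ} (h : HasDerivAt F D 0) (h0 : F 0 = 0) (hD : 0 < D) :
    ∀ᶠ w in 𝓝[>] (0 : ℝ), 0 < F w := by
  have h1 := (hasDerivAt_iff_tendsto_slope.1 h).mono_left
    (nhdsWithin_mono (0 : ℝ) (fun x (hx : 0 < x) => ne_of_gt hx))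
  filter_upwards [h1.eventually (lt_mem_nhds hD), self_mem_nhdsWithin] with w hw hw0
  have hw0 : 0 < w := hw0
  rw [slope_def_field, h0, sub_zero, sub_zero] at hw
  exact (div_pos_iff_of_pos_right hw0).1 hw

lemma ev_lin (M : ℕ) (s : ℕ → ℝ) :
    ∀ᶠ w in 𝓝[>] (0 : ℝ), ∀ j ∈ range (M + 1), 0 < 1 + w * s j := by
  rw [Filter.eventually_all_finset]
  intro j _
  have : Tendsto (fun w : ℝ => 1 + w * s j) (𝓝 0) (𝓝 (1 + 0 * s j)) :=
    (Continuous.tendsto (by fun_prop) 0)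
  exact (this.mono_left nhdsWithin_le_nhds).eventually (lt_mem_nhds (by simp))

lemma slope_sum (a b c d : ℝ) (M : ℕ) (hM : 1 ≤ M) (n : ℕ) :
    ∑ j ∈ range n, (a * (j : ℝ) + b * ((M : ℝ) - j)) / (M : ℝ)
     - ∑ j ∈ range n, (c * ((j : ℝ) + 1) + d * ((M : ℝ) - j - 1)) / (M : ℝ)
     = ((a - b - c + d) * (n * (n - 1) / 2) + (b * M - c - d * (M - 1)) * n) / M := by
  induction n with
  | zero => simp
  | succ n ih =>
    rw [Finset.sum_range_succ, Finset.sum_range_succ, add_sub_add_comm, ih]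
    push_cast
    field_simp
    ring

lemma fA_eq (a b : ℝ) (M : ℕ) (w : ℝ) (j : ℕ) :
    fA a b (M + 1) w (j + 1) = 1 + w * ((a * (j : ℝ) + b * ((M : ℝ) - j)) / (M : ℝ)) := by
  unfold fA
  push_cast
  rw [mul_div_assoc]
  congr 4 <;> ring

lemma fB_eq (c d : ℝ) (M : ℕ) (w : ℝ) (j : ℕ) :
    fB c d (M + 1) w (j + 1)
      = 1 + w * ((c * ((j : ℝ) + 1) + d * ((M : ℝ) - j - 1)) / (M : ℝ)) := by
  unfold fB
  push_cast
  rw [mul_div_assoc]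
  congr 4 <;> ring

lemma ev_iff (a b c d : ℝ) (M : ℕ) :
    ∀ᶠ w in 𝓝[>] (0 : ℝ), (rhoA a b c d (M + 1) w > rhoB a b c d (M + 1) w ↔
      ∏ j ∈ range M, fB c d (M + 1) w (j + 1) < ∏ j ∈ range M, fA a b (M + 1) w (j + 1)) := by
  filter_upwards [ev_lin M (fun j => (a * (j : ℝ) + b * ((M : ℝ) - j)) / (M : ℝ)),
    ev_lin M (fun j => (c * ((j : ℝ) + 1) + d * ((M : ℝ) - j - 1)) / (M : ℝ))] with w h1 h2
  apply rho_iff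
  · intro j hj hj'
    obtain ⟨i, rfl⟩ : ∃ i, j = i + 1 := ⟨j - 1, by omega⟩
    rw [fA_eq]
    exact h1 i (Finset.mem_range.2 (by omega))
  · intro j hj hj'
    obtain ⟨i, rfl⟩ : ∃ i, j = i + 1 := ⟨j - 1, by omega⟩
    rw [fB_eq]
    exact h2 i (Finset.mem_range.2 (by omega))

lemma F_deriv (a b c d : ℝ) (M : ℕ) (hM : 1 ≤ M) :
    HasDerivAt (fun w => ∏ j ∈ range M, fA a b (M + 1) w (j + 1)
        - ∏ j ∈ range M, fB c d (M + 1) w (j + 1))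
      (((a + b - c - d) * (M + 1) - 2 * (a - d)) / 2) 0 := by
  simp only [fA_eq, fB_eq]
  have h := (fin_prod_deriv M (fun j => (a * (j : ℝ) + b * ((M : ℝ) - j)) / (M : ℝ))).sub
    (fin_prod_deriv M (fun j => (c * ((j : ℝ) + 1) + d * ((M : ℝ) - j - 1)) / (M : ℝ)))
  rw [slope_sum a b c d M hM M] at h
  have hM0 : (M : ℝ) ≠ 0 := by positivity
  refine h.congr_deriv ?_
  field_simp
  ring

lemma F_zero (a b c d : ℝ) (M : ℕ) :
    ∏ j ∈ range M, fA a b (M + 1) 0 (j + 1) - ∏ j ∈ range M, fB c d (M + 1) 0 (j + 1) = 0 := by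
  simp [fA, fB]

lemma prod_fB_eq_fA (a b : ℝ) (M : ℕ) (w : ℝ) :
    ∏ j ∈ range M, fB b a (M + 1) w (j + 1) = ∏ j ∈ range M, fA a b (M + 1) w (j + 1) := by
  rw [← Finset.prod_range_reflect]
  apply Finset.prod_congr rfl
  intro j hj
  have hj := Finset.mem_range.1 hj
  obtain ⟨m, rfl⟩ : ∃ m, M = m + 1 + j := ⟨M - 1 - j, by omega⟩
  rw [fA_eq, fB_eq, show m + 1 + j - 1 - j = m by omega]
  push_cast
  congr 3
  ring

lemma ev_of (P : ℝ → Prop) :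
    (∃ w' > (0 : ℝ), ∀ w : ℝ, 0 < w → w < w' → P w) ↔ ∀ᶠ w in 𝓝[>] (0 : ℝ), P w := by
  rw [Filter.Eventually, mem_nhdsGT_iff_exists_Ioo_subset]
  constructor
  · rintro ⟨u, hu, h⟩
    exact ⟨u, hu, fun w hw => h w hw.1 hw.2⟩
  · rintro ⟨u, hu, h⟩
    exact ⟨u, hu, fun w h1 h2 => h ⟨h1, h2⟩⟩

/-- In the wN limit, ρ_A > ρ_B iff a + b > c + d, or a + b = c + d and b > c. -/
theorem rhoA_gt_rhoB_wN (a b c d : ℝ) :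
    (∃ N₀ : ℕ, ∀ N : ℕ, N₀ ≤ N → ∃ w' > (0 : ℝ), ∀ w : ℝ, 0 < w → w < w' →
        rhoA a b c d N w > rhoB a b c d N w) ↔
      (a + b > c + d ∨ (a + b = c + d ∧ b > c)) := by
  simp only [ev_of]
  have pos : ∀ M : ℕ, 1 ≤ M → 0 < ((a + b - c - d) * (M + 1) - 2 * (a - d)) / 2 →
      ∀ᶠ w in 𝓝[>] (0 : ℝ), rhoA a b c d (M + 1) w > rhoB a b c d (M + 1) w := by
    intro M hM hD
    filter_upwards [ev_iff a b c d M, ev_pos (F_deriv a b c d M hM) (F_zero a b c d M) hD]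
      with w h1 h2
    exact h1.2 (sub_pos.1 h2)
  have large : ∀ x y : ℝ, 0 < x → ∃ n₀ : ℕ, ∀ M : ℕ, n₀ ≤ M → 0 < (x * (M + 1) - 2 * y) / 2 := by
    intro x y hx
    obtain ⟨n, hn⟩ := exists_nat_gt (2 * y / x)
    refine ⟨n, fun M hM => ?_⟩
    have hM' : (n : ℝ) ≤ M := by exact_mod_cast hM
    rw [div_lt_iff₀ hx] at hn
    nlinarith
  constructor
  · rintro ⟨N₀, hN⟩
    by_contra hcon
    rw [not_or, not_and] at hcon
    obtain ⟨h1, h2⟩ := hcon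
    have neg : ∀ M : ℕ, 1 ≤ M → N₀ ≤ M →
        ¬ ((a + b - c - d) * (M + 1) - 2 * (a - d)) / 2 < 0 := by
      intro M hM hM0 hD
      have hd := (F_deriv a b c d M hM).neg
      have h3 := ev_pos hd (by simp [fA, fB]) (neg_pos.2 hD)
      obtain ⟨w, h4, h5, h6⟩ := (h3.and ((ev_iff a b c d M).and (hN (M + 1) (by omega)))).exists
      have := h5.1 h6
      simp only [Pi.neg_apply] at h4
      linarith
    rcases lt_or_eq_of_le (not_lt.1 h1) with hlt | heq
    · obtain ⟨n, hn⟩ := large (c + d - a - b) (d - a) (by linarith)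
      have := hn (max n (max 1 N₀)) (le_max_left _ _)
      refine neg (max n (max 1 N₀)) (by simp) (by simp) ?_
      linarith
    · rcases lt_or_eq_of_le (not_lt.1 (h2 heq)) with hbc | hbc
      · refine neg (max 1 N₀) (by simp) (by simp) ?_
        have h0 : a + b - c - d = 0 := by linarith
        rw [h0]
        linarith
      · subst hbc
        have hda : d = a := by linarith
        subst hda
        obtain ⟨w, h5, h6⟩ := ((ev_iff d b b d N₀).and (hN (N₀ + 1) (by omega))).exists
        have := h5.1 h6
        rw [prod_fB_eq_fA] at this
        exact lt_irrefl _ this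
  · rintro (h | ⟨h, h'⟩)
    · obtain ⟨n, hn⟩ := large (a + b - c - d) (a - d) (by linarith)
      refine ⟨n + 2, fun N hN => ?_⟩
      obtain ⟨M, rfl⟩ : ∃ M, N = M + 1 := ⟨N - 1, by omega⟩
      exact pos M (by omega) (hn M (by omega))
    · refine ⟨2, fun N hN => ?_⟩
      obtain ⟨M, rfl⟩ : ∃ M, N = M + 1 := ⟨N - 1, by omega⟩
      refine pos M (by omega) ?_
      have h0 : a + b - c - d = 0 := by linarith
      rw [h0]
      linarith
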